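/- arXiv:0810.1382 — 4 statements merged into one kernel-verified Lean document; each statement's English description precedes it below -/
import Mathlib

section
/- For each k ∈ {3,…,9}, let I_k ⊆ ℂ[u,v] be the ideal generated by all monomials u^a v^b (a,b ∈ ℕ) satisfying 2a + 15b ≥ 5k − 16 and 3a + 10b ≥ 5k − 12. Then I_3 = (u, v), I_4 = (u³, v), I_5 = (u⁵, uv, v²), I_6 = (u⁷, u³v, v²), I_7 = (u¹⁰, u⁵v, uv², v³), I_8 = (u¹², u⁶v, u³v², v³), I_9 = (u¹⁵, u⁸v, u⁵v², uv³, v⁴), and the ℂ-dimension of ℂ[u,v]/I_k for k = 3,…,9 equals 1, 3, 6, 10, 16, 21, 29 respectively. -/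
open MvPolynomial

noncomputable def u : MvPolynomial (Fin 2) ℂ := MvPolynomial.X 0
noncomputable def v : MvPolynomial (Fin 2) ℂ := MvPolynomial.X 1

/-- The monomial ideal given by the criterion of Lemma 2 for the singularity
`B_{15,2}∘B_{10,3}` (weight vectors `Q₁ = (2,15)`, `Q₂ = (3,10)`, degree `d = 10`). -/
noncomputable def I₁₅₁₀ (k : ℕ) : Ideal (MvPolynomial (Fin 2) ℂ) :=
  Ideal.span {m | ∃ a b : ℕ, m = u ^ a * v ^ b ∧
    (2 * a + 15 * b : ℤ) ≥ 5 * (k : ℤ) - 16 ∧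
    (3 * a + 10 * b : ℤ) ≥ 5 * (k : ℤ) - 12}

/-- The inequalities selecting the exponents `(a, b)` of the monomials `u ^ a * v ^ b` in
`I₁₅₁₀ k`. -/
abbrev AdjunctionCondition (k : ℕ) (e : ℕ × ℕ) : Prop :=
  (2 * e.1 + 15 * e.2 : ℤ) ≥ 5 * (k : ℤ) - 16 ∧ (3 * e.1 + 10 * e.2 : ℤ) ≥ 5 * (k : ℤ) - 12

theorem I₁₅₁₀_eq_span_image (k : ℕ) (E : Set (ℕ × ℕ))
    (hE : ∀ e ∈ E, AdjunctionCondition k e)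
    (hdvd : ∀ a b : ℕ, AdjunctionCondition k (a, b) → ∃ e ∈ E, e.1 ≤ a ∧ e.2 ≤ b) :
    I₁₅₁₀ k = Ideal.span ((fun e : ℕ × ℕ => u ^ e.1 * v ^ e.2) '' E) := by
  apply le_antisymm
  · refine Ideal.span_le.2 ?_
    rintro _ ⟨a, b, rfl, hab⟩
    obtain ⟨e, he, ha, hb⟩ := hdvd a b hab
    exact Ideal.mem_of_dvd _ (mul_dvd_mul (pow_dvd_pow u ha) (pow_dvd_pow v hb))
      (Ideal.subset_span ⟨e, he, rfl⟩)
  · refine Ideal.span_mono ?_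
    rintro _ ⟨e, he, rfl⟩
    exact ⟨e.1, e.2, rfl, hE e he⟩

theorem u_pow_mul_v_pow_eq_monomial (m : Fin 2 →₀ ℕ) :
    u ^ m 0 * v ^ m 1 = monomial m (1 : ℂ) := by
  rw [monomial_eq, Finsupp.prod_fintype _ _ (by simp), Fin.prod_univ_two, C_1, one_mul, u, v]

theorem mem_I₁₅₁₀_iff (k : ℕ) (p : MvPolynomial (Fin 2) ℂ) :
    p ∈ I₁₅₁₀ k ↔ ∀ m ∈ p.support, AdjunctionCondition k (m 0, m 1) := by
  have hspan : I₁₅₁₀ k = Ideal.span ((fun m => monomial m (1 : ℂ)) ''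
      {m : Fin 2 →₀ ℕ | AdjunctionCondition k (m 0, m 1)}) := by
    refine congrArg Ideal.span (Set.ext fun q => ⟨?_, ?_⟩)
    · rintro ⟨a, b, rfl, hab⟩
      refine ⟨Finsupp.equivFunOnFinite.symm ![a, b], hab, ?_⟩
      exact (u_pow_mul_v_pow_eq_monomial _).symm
    · rintro ⟨m, hm, rfl⟩
      exact ⟨m 0, m 1, (u_pow_mul_v_pow_eq_monomial m).symm, hm⟩
  rw [hspan, mem_ideal_span_monomial_image]
  refine forall₂_congr fun m _ => ⟨?_, fun hm => ⟨m, hm, le_rfl⟩⟩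
  rintro ⟨n, ⟨h₁, h₂⟩, hnm⟩
  have h0 := hnm 0
  have h1 := hnm 1
  dsimp only at h₁ h₂
  constructor <;> dsimp only <;> omega

/-- The exponents of the monomials outside `I₁₅₁₀ k`. -/
def standardExponents (k : ℕ) : Finset (ℕ × ℕ) :=
  (Finset.range (3 * k) ×ˢ Finset.range k).filter fun e => ¬ AdjunctionCondition k e

theorem mem_standardExponents {k : ℕ} {e : ℕ × ℕ} :
    e ∈ standardExponents k ↔ ¬ AdjunctionCondition k e := by
  simp only [standardExponents, Finset.mem_filter, Finset.mem_product, Finset.mem_range,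
    AdjunctionCondition]
  omega

theorem finrank_quotient_I₁₅₁₀ (k : ℕ) :
    Module.finrank ℂ (MvPolynomial (Fin 2) ℂ ⧸ I₁₅₁₀ k) = (standardExponents k).card := by
  let exponent (e : ℕ × ℕ) : Fin 2 →₀ ℕ := Finsupp.equivFunOnFinite.symm ![e.1, e.2]
  let φ : MvPolynomial (Fin 2) ℂ →ₗ[ℂ] (standardExponents k → ℂ) :=
    LinearMap.pi fun e => lcoeff ℂ (exponent e)
  have hφ (p) (e : standardExponents k) : φ p e = coeff (exponent e) p := rfl
  have hker : LinearMap.ker φ = (I₁₅₁₀ k).restrictScalars ℂ := by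
    ext p
    rw [LinearMap.mem_ker, Submodule.restrictScalars_mem, mem_I₁₅₁₀_iff]
    constructor
    · intro hp m hm
      by_contra hcond
      refine mem_support_iff.1 hm ?_
      have hm' : exponent (m 0, m 1) = m := by
        ext i
        fin_cases i <;> rfl
      rw [← hm']
      exact congrFun hp ⟨(m 0, m 1), mem_standardExponents.2 hcond⟩
    · intro hp
      ext e
      by_contra hne
      exact mem_standardExponents.1 e.2 (hp (exponent e) (mem_support_iff.2 hne))
  have hsurj : Function.Surjective φ := by
    intro c
    refine ⟨∑ d : standardExponents k, monomial (exponent d) (c d), funext fun e => ?_⟩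
    have hinj (d : standardExponents k) : exponent d = exponent e ↔ d = e := by
      refine ⟨fun h => ?_, fun h => by rw [h]⟩
      exact Subtype.ext (Prod.ext (DFunLike.congr_fun h 0) (DFunLike.congr_fun h 1))
    simp [hφ, coeff_sum, coeff_monomial, hinj]
  have equiv := (Submodule.quotEquivOfEq _ _ hker).symm.trans
    (φ.quotKerEquivOfSurjective hsurj)
  have hrank := equiv.finrank_eq
  rw [Module.finrank_fintype_fun_eq_card, Fintype.card_coe] at hrank
  exact hrank

theorem adjunction_ideals_B152_B103 :
    I₁₅₁₀ 3 = Ideal.span {u, v} ∧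
    I₁₅₁₀ 4 = Ideal.span {u ^ 3, v} ∧
    I₁₅₁₀ 5 = Ideal.span {u ^ 5, u * v, v ^ 2} ∧
    I₁₅₁₀ 6 = Ideal.span {u ^ 7, u ^ 3 * v, v ^ 2} ∧
    I₁₅₁₀ 7 = Ideal.span {u ^ 10, u ^ 5 * v, u * v ^ 2, v ^ 3} ∧
    I₁₅₁₀ 8 = Ideal.span {u ^ 12, u ^ 6 * v, u ^ 3 * v ^ 2, v ^ 3} ∧
    I₁₅₁₀ 9 = Ideal.span {u ^ 15, u ^ 8 * v, u ^ 5 * v ^ 2, u * v ^ 3, v ^ 4} ∧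
    Module.finrank ℂ (MvPolynomial (Fin 2) ℂ ⧸ I₁₅₁₀ 3) = 1 ∧
    Module.finrank ℂ (MvPolynomial (Fin 2) ℂ ⧸ I₁₅₁₀ 4) = 3 ∧
    Module.finrank ℂ (MvPolynomial (Fin 2) ℂ ⧸ I₁₅₁₀ 5) = 6 ∧
    Module.finrank ℂ (MvPolynomial (Fin 2) ℂ ⧸ I₁₅₁₀ 6) = 10 ∧
    Module.finrank ℂ (MvPolynomial (Fin 2) ℂ ⧸ I₁₅₁₀ 7) = 16 ∧
    Module.finrank ℂ (MvPolynomial (Fin 2) ℂ ⧸ I₁₅₁₀ 8) = 21 ∧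
    Module.finrank ℂ (MvPolynomial (Fin 2) ℂ ⧸ I₁₅₁₀ 9) = 29 := by
  refine ⟨?_, ?_, ?_, ?_, ?_, ?_, ?_, ?_, ?_, ?_, ?_, ?_, ?_, ?_⟩
  · simpa [Set.image_insert_eq] using I₁₅₁₀_eq_span_image 3 {(1, 0), (0, 1)}
      (by simp [AdjunctionCondition]) (by simp; omega)
  · simpa [Set.image_insert_eq] using I₁₅₁₀_eq_span_image 4 {(3, 0), (0, 1)}
      (by simp [AdjunctionCondition]) (by simp; omega)
  · simpa [Set.image_insert_eq] using I₁₅₁₀_eq_span_image 5 {(5, 0), (1, 1), (0, 2)}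
      (by simp [AdjunctionCondition]) (by simp; omega)
  · simpa [Set.image_insert_eq] using I₁₅₁₀_eq_span_image 6 {(7, 0), (3, 1), (0, 2)}
      (by simp [AdjunctionCondition]) (by simp; omega)
  · simpa [Set.image_insert_eq] using I₁₅₁₀_eq_span_image 7 {(10, 0), (5, 1), (1, 2), (0, 3)}
      (by simp [AdjunctionCondition]) (by simp; omega)
  · simpa [Set.image_insert_eq] using I₁₅₁₀_eq_span_image 8 {(12, 0), (6, 1), (3, 2), (0, 3)}
      (by simp [AdjunctionCondition]) (by simp; omega)
  · simpa [Set.image_insert_eq] using I₁₅₁₀_eq_span_image 9 {(15, 0), (8, 1), (5, 2), (1, 3), (0, 4)}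
      (by simp [AdjunctionCondition]) (by simp; omega)
  all_goals
    rw [finrank_quotient_I₁₅₁₀]
    rfl
end

section
/- Let f = u²⁵ + u¹⁰v² + v⁵ in the formal power series ring ℂ⟦u,v⟧, and for k ∈ {3,…,9} let I_k ⊆ ℂ⟦u,v⟧ be the ideal generated by all monomials u^a v^b with 2a + 15b ≥ 5k − 16 and 3a + 10b ≥ 5k − 12. Then for every nonzero g ∈ I_k, the ℂ-dimension of ℂ⟦u,v⟧/(f, g) is strictly greater than 10(k − 3). -/
/-- `u` in `ℂ⟦u,v⟧`. -/
noncomputable def U : MvPowerSeries (Fin 2) ℂ := MvPowerSeries.X 0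
/-- `v` in `ℂ⟦u,v⟧`. -/
noncomputable def V : MvPowerSeries (Fin 2) ℂ := MvPowerSeries.X 1

/-- The adjunction ideal `J_{O,k,10}` of the singularity `B_{15,2}∘B_{10,3}`. -/
noncomputable def J₁₅₁₀ (k : ℕ) : Ideal (MvPowerSeries (Fin 2) ℂ) :=
  Ideal.span {m | ∃ a b : ℕ, m = U ^ a * V ^ b ∧
    (2 * a + 15 * b : ℤ) ≥ 5 * (k : ℤ) - 16 ∧
    (3 * a + 10 * b : ℤ) ≥ 5 * (k : ℤ) - 12}

/-- The exponent vector of `u ^ a * v ^ b`. -/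
noncomputable def expo (a b : ℕ) : Fin 2 →₀ ℕ := Finsupp.single 0 a + Finsupp.single 1 b

/-- A power series has order at least `m` for the weights `(2, 15)` and at least `n` for the
weights `(3, 10)`. -/
def HasOrders (m n : ℕ) (h : MvPowerSeries (Fin 2) ℂ) : Prop :=
  ∀ d : Fin 2 →₀ ℕ, 2 * d 0 + 15 * d 1 < m ∨ 3 * d 0 + 10 * d 1 < n →
    MvPowerSeries.coeff d h = 0

lemma HasOrders.add {m n : ℕ} {h₁ h₂ : MvPowerSeries (Fin 2) ℂ}
    (H₁ : HasOrders m n h₁) (H₂ : HasOrders m n h₂) : HasOrders m n (h₁ + h₂) := by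
  intro d hd
  rw [map_add, H₁ d hd, H₂ d hd, add_zero]

lemma HasOrders.mul {m n m' n' : ℕ} {h₁ h₂ : MvPowerSeries (Fin 2) ℂ}
    (H₁ : HasOrders m n h₁) (H₂ : HasOrders m' n' h₂) :
    HasOrders (m + m') (n + n') (h₁ * h₂) := by
  classical
  intro d hd
  rw [MvPowerSeries.coeff_mul]
  refine Finset.sum_eq_zero fun p hp => ?_
  rw [Finset.HasAntidiagonal.mem_antidiagonal] at hp
  have e0 : p.1 0 + p.2 0 = d 0 := by rw [← hp, Finsupp.add_apply]
  have e1 : p.1 1 + p.2 1 = d 1 := by rw [← hp, Finsupp.add_apply]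
  by_cases c : 2 * p.1 0 + 15 * p.1 1 < m ∨ 3 * p.1 0 + 10 * p.1 1 < n
  · rw [H₁ _ c, zero_mul]
  · rw [H₂ p.2 (by omega), mul_zero]

lemma hasOrders_zero_zero (h : MvPowerSeries (Fin 2) ℂ) : HasOrders 0 0 h := by
  intro d hd
  omega

lemma U_pow_mul_V_pow (a b : ℕ) : U ^ a * V ^ b = MvPowerSeries.monomial (expo a b) 1 := by
  rw [U, V, MvPowerSeries.X_pow_eq, MvPowerSeries.X_pow_eq, MvPowerSeries.monomial_mul_monomial,
    one_mul, expo]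

lemma hasOrders_monomial {m n a b : ℕ} (hm : m ≤ 2 * a + 15 * b) (hn : n ≤ 3 * a + 10 * b) :
    HasOrders m n (U ^ a * V ^ b) := by
  classical
  intro d hd
  rw [U_pow_mul_V_pow, MvPowerSeries.coeff_monomial, if_neg]
  rintro rfl
  simp [expo] at hd
  omega

lemma hasOrders_equation : HasOrders 50 50 (U ^ 25 + U ^ 10 * V ^ 2 + V ^ 5) := by
  have h₁ := hasOrders_monomial (m := 50) (n := 50) (a := 25) (b := 0) (by norm_num) (by norm_num)
  have h₂ := hasOrders_monomial (m := 50) (n := 50) (a := 0) (b := 5) (by norm_num) (by norm_num)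
  rw [pow_zero, mul_one] at h₁
  rw [pow_zero, one_mul] at h₂
  exact (h₁.add (hasOrders_monomial (by norm_num) (by norm_num))).add h₂

lemma hasOrders_of_mem_J₁₅₁₀ {k : ℕ} {g : MvPowerSeries (Fin 2) ℂ} (hg : g ∈ J₁₅₁₀ k) :
    HasOrders (5 * k - 16) (5 * k - 12) g := by
  induction hg using Submodule.span_induction with
  | mem x hx =>
    obtain ⟨a, b, rfl, h₁, h₂⟩ := hx
    exact hasOrders_monomial (by omega) (by omega)
  | zero => exact fun d _ => map_zero _
  | add x y _ _ hx hy => exact hx.add hy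
  | smul r x _ hx => simpa using (hasOrders_zero_zero r).mul hx

/-- The exponents in the box `[0, 40) × [0, 9)` of weight below `m` for `(2, 15)` or below `n`
for `(3, 10)`. -/
def lowExponents (m n : ℕ) : Finset (ℕ × ℕ) :=
  {p ∈ Finset.range 40 ×ˢ Finset.range 9 | 2 * p.1 + 15 * p.2 < m ∨ 3 * p.1 + 10 * p.2 < n}

/-- The coefficients of a power series at the exponents in `s`. -/
noncomputable def coeffsAt (s : Finset (ℕ × ℕ)) : MvPowerSeries (Fin 2) ℂ →ₗ[ℂ] (s → ℂ) :=
  LinearMap.pi fun p => MvPowerSeries.coeff (expo p.1.1 p.1.2)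

lemma coeffsAt_surjective (s : Finset (ℕ × ℕ)) : Function.Surjective (coeffsAt s) := by
  classical
  intro w
  refine ⟨fun d => if h : (d 0, d 1) ∈ s then w ⟨_, h⟩ else 0, ?_⟩
  ext ⟨⟨a, b⟩, hp⟩
  change (if h : (expo a b 0, expo a b 1) ∈ s then w ⟨_, h⟩ else 0) = w ⟨(a, b), hp⟩
  have h0 : expo a b 0 = a := by simp [expo]
  have h1 : expo a b 1 = b := by simp [expo]
  simp only [h0, h1, hp, dite_true]

lemma coeffsAt_lowExponents_eq_zero_iff {m n : ℕ} (hm : m ≤ 80) (hn : n ≤ 90)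
    {h : MvPowerSeries (Fin 2) ℂ} : coeffsAt (lowExponents m n) h = 0 ↔ HasOrders m n h := by
  constructor
  · intro H d hd
    have hmem : (d 0, d 1) ∈ lowExponents m n := by
      simp only [lowExponents, Finset.mem_filter, Finset.mem_product, Finset.mem_range]
      omega
    have hd' : expo (d 0) (d 1) = d := by
      ext i
      fin_cases i <;> simp [expo]
    have := congrFun H ⟨_, hmem⟩
    simpa [coeffsAt, hd'] using this
  · intro H
    ext ⟨⟨a, b⟩, hp⟩
    refine H _ ?_
    simpa [expo] using (Finset.mem_filter.1 hp).2

/-- If the products `p * f` and `q * g` are determined in a quotient `W` of `A` by the classes of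
`p` and `q` in quotients `P` and `Q`, then `A ⧸ (f, g)` has dimension at least
`dim W - (dim P + dim Q)`. -/
lemma finrank_sub_le_rank_quotient_span_pair {K A W P Q : Type*} [Field K] [CommRing A]
    [Algebra K A] [AddCommGroup W] [Module K W] [FiniteDimensional K W]
    [AddCommGroup P] [Module K P] [FiniteDimensional K P]
    [AddCommGroup Q] [Module K Q] [FiniteDimensional K Q]
    (w : A →ₗ[K] W) (hw : Function.Surjective w)
    (p : A →ₗ[K] P) (hp : Function.Surjective p)
    (q : A →ₗ[K] Q) (hq : Function.Surjective q) {f g : A}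
    (hf : ∀ x, p x = 0 → w (x * f) = 0) (hg : ∀ x, q x = 0 → w (x * g) = 0) :
    ((Module.finrank K W - (Module.finrank K P + Module.finrank K Q) : ℕ) : Cardinal) ≤
      Module.rank K (A ⧸ Ideal.span {f, g}) := by
  obtain ⟨s, hs⟩ := p.exists_rightInverse_of_surjective (LinearMap.range_eq_top.2 hp)
  obtain ⟨t, ht⟩ := q.exists_rightInverse_of_surjective (LinearMap.range_eq_top.2 hq)
  let Φ : P × Q →ₗ[K] W :=
    (w ∘ₗ LinearMap.mulRight K f ∘ₗ s).coprod (w ∘ₗ LinearMap.mulRight K g ∘ₗ t)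
  have hΦ : ∀ x ∈ (Ideal.span {f, g}).restrictScalars K, w x ∈ LinearMap.range Φ := by
    intro x hx
    obtain ⟨a, b, rfl⟩ := Ideal.mem_span_pair.1 hx
    refine ⟨(p a, q b), ?_⟩
    have ha : w ((a - s (p a)) * f) = 0 := hf _ <| by
      rw [map_sub, sub_eq_zero]
      exact (LinearMap.congr_fun hs (p a)).symm
    have hb : w ((b - t (q b)) * g) = 0 := hg _ <| by
      rw [map_sub, sub_eq_zero]
      exact (LinearMap.congr_fun ht (q b)).symm
    rw [sub_mul, map_sub, sub_eq_zero] at ha hb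
    simp [Φ, ha, hb]
  let F := ((Ideal.span {f, g}).restrictScalars K).mapQ (LinearMap.range Φ) w hΦ
  have hF : Function.Surjective F := by
    intro y
    obtain ⟨y, rfl⟩ := Submodule.mkQ_surjective _ y
    obtain ⟨x, rfl⟩ := hw y
    exact ⟨Submodule.Quotient.mk x, rfl⟩
  have h₁ := (LinearMap.range Φ).finrank_quotient_add_finrank
  have h₂ := LinearMap.finrank_range_le Φ
  rw [Module.finrank_prod] at h₂
  have h₃ := LinearMap.lift_rank_le_of_surjective F hF
  rw [← Module.finrank_eq_rank, Cardinal.lift_natCast, Cardinal.nat_le_lift_iff] at h₃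
  exact le_trans (by exact_mod_cast (by omega)) h₃

lemma lt_card_lowExponents_sub (k : ℕ) (hk3 : 3 ≤ k) (hk9 : k ≤ 9) :
    10 * (k - 3) < (lowExponents (5 * k - 16 + 50) (5 * k - 12 + 50)).card -
      ((lowExponents (5 * k - 16) (5 * k - 12)).card + (lowExponents 50 50).card) := by
  interval_cases k <;> decide +kernel

/-- For `f = u²⁵ + u¹⁰v² + v⁵` and any nonzero `g` in the adjunction ideal
`J_{O,k,10}`, `3 ≤ k ≤ 9`, the intersection number `dim_ℂ ℂ⟦u,v⟧/(f,g)` is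
strictly greater than `10(k-3)`. -/
theorem iota_B152_B103 (k : ℕ) (hk3 : 3 ≤ k) (hk9 : k ≤ 9)
    (g : MvPowerSeries (Fin 2) ℂ) (hg : g ∈ J₁₅₁₀ k) (hg0 : g ≠ 0) :
    ((10 * (k - 3) : ℕ) : Cardinal) <
      Module.rank ℂ
        (MvPowerSeries (Fin 2) ℂ ⧸
          Ideal.span {U ^ 25 + U ^ 10 * V ^ 2 + V ^ 5, g}) := by
  have key := finrank_sub_le_rank_quotient_span_pair
    (coeffsAt (lowExponents (5 * k - 16 + 50) (5 * k - 12 + 50))) (coeffsAt_surjective _)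
    (coeffsAt (lowExponents (5 * k - 16) (5 * k - 12))) (coeffsAt_surjective _)
    (coeffsAt (lowExponents 50 50)) (coeffsAt_surjective _)
    (f := U ^ 25 + U ^ 10 * V ^ 2 + V ^ 5) (g := g)
    (fun x hx => by
      rw [coeffsAt_lowExponents_eq_zero_iff (by omega) (by omega)] at hx ⊢
      exact hx.mul hasOrders_equation)
    (fun x hx => by
      rw [coeffsAt_lowExponents_eq_zero_iff (by omega) (by omega)] at hx ⊢
      rw [add_comm _ 50, add_comm _ 50]
      exact hx.mul (hasOrders_of_mem_J₁₅₁₀ hg))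
  simp only [Module.finrank_fintype_fun_eq_card, Fintype.card_coe] at key
  exact lt_of_lt_of_le (by exact_mod_cast lt_card_lowExponents_sub k hk3 hk9) key
end

section
/- Let f = u²⁵ + v⁴ in the formal power series ring ℂ⟦u,v⟧, and for k ∈ {3,…,9} let I_k ⊆ ℂ⟦u,v⟧ be the ideal generated by all monomials u^a v^b with 4a + 25b ≥ 10k − 28. Then for every nonzero g ∈ I_k, the ℂ-dimension of ℂ⟦u,v⟧/(f, g) is strictly greater than 10(k − 3). -/
/-- The adjunction ideal `J_{O,k,10}` of the singularity `B_{25,4}`. -/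
noncomputable def J₂₅₄ (k : ℕ) : Ideal (MvPowerSeries (Fin 2) ℂ) :=
  Ideal.span {m | ∃ a b : ℕ, m = U ^ a * V ^ b ∧
    (4 * a + 25 * b : ℤ) ≥ 10 * (k : ℤ) - 28}

open PowerSeries in
/-- The two power series parametrising the branch `u = t⁴`, `v = ζ t²⁵`. -/
noncomputable def branch (ζ : ℂ) : Fin 2 → MvPowerSeries Unit ℂ :=
  ![(X ^ 4 : ℂ⟦X⟧), (C ζ * X ^ 25 : ℂ⟦X⟧)]

lemma hasSubst_branch (ζ : ℂ) : MvPowerSeries.HasSubst (branch ζ) := by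
  refine MvPowerSeries.hasSubst_of_constantCoeff_zero fun s => ?_
  change PowerSeries.constantCoeff (branch ζ s) = 0
  fin_cases s <;> simp [branch]

/-- Pullback of power series in two variables along the branch. -/
noncomputable def pullback (ζ : ℂ) : MvPowerSeries (Fin 2) ℂ →ₐ[ℂ] PowerSeries ℂ :=
  MvPowerSeries.substAlgHom (hasSubst_branch ζ)

open PowerSeries in
lemma pullback_U (ζ : ℂ) : pullback ζ U = X ^ 4 :=
  (MvPowerSeries.substAlgHom_X (hasSubst_branch ζ) 0).trans rfl

open PowerSeries in
lemma pullback_V (ζ : ℂ) : pullback ζ V = C ζ * X ^ 25 :=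
  (MvPowerSeries.substAlgHom_X (hasSubst_branch ζ) 1).trans rfl

open PowerSeries in
lemma pullback_monomial (ζ : ℂ) (a b : ℕ) :
    pullback ζ (U ^ a * V ^ b) = C (ζ ^ b) * X ^ (4 * a + 25 * b) := by
  rw [map_mul, map_pow, map_pow, pullback_U, pullback_V, map_pow]
  ring

open PowerSeries in
lemma pullback_eq_zero {ζ : ℂ} (hζ : ζ ^ 4 = -1) : pullback ζ (U ^ 25 + V ^ 4) = 0 := by
  rw [map_add, map_pow, map_pow, pullback_U, pullback_V, mul_pow, ← map_pow, hζ, map_neg, map_one]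
  ring

lemma exists_of_coeff_pullback_ne_zero {ζ : ℂ} {x : MvPowerSeries (Fin 2) ℂ} {n : ℕ}
    (h : PowerSeries.coeff n (pullback ζ x) ≠ 0) : ∃ a b : ℕ, n = 4 * a + 25 * b := by
  rw [pullback, MvPowerSeries.substAlgHom_apply, PowerSeries.coeff,
    MvPowerSeries.coeff_subst (hasSubst_branch ζ)] at h
  obtain ⟨d, -, hd⟩ := exists_ne_zero_of_finsum_mem_ne_zero (s := Set.univ)
    ((finsum_mem_univ _).trans_ne h)
  refine ⟨d 0, d 1, ?_⟩
  have hprod : (d.prod fun s e => branch ζ s ^ e) = pullback ζ (U ^ d 0 * V ^ d 1) := by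
    rw [Finsupp.prod_fintype _ _ (by simp), Fin.prod_univ_two, map_mul, map_pow, map_pow,
      pullback_U, pullback_V]
    rfl
  have hd' := right_ne_zero_of_smul hd
  rw [hprod, pullback_monomial] at hd'
  change PowerSeries.coeff n _ ≠ 0 at hd'
  rw [PowerSeries.coeff_C_mul, PowerSeries.coeff_X_pow] at hd'
  by_contra hne
  simp [hne] at hd'

/-- The numerical semigroup `⟨4, 25⟩` meets every residue class modulo `N`. -/
lemma exists_mod_eq {N : ℕ} (r : Fin N) :
    ∃ s : ℕ, (∃ a b : ℕ, s = 4 * a + 25 * b) ∧ s % N = r := by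
  have hr := r.2
  refine ⟨r + 72 * N, ⟨(r + 72 * N - 25 * ((r + 72 * N) % 4)) / 4, (r + 72 * N) % 4, ?_⟩, ?_⟩
  · omega
  · rw [Nat.add_mul_mod_self_right, Nat.mod_eq_of_lt hr]

/-- The Apéry set of `⟨4, 25⟩` with respect to `N`. -/
lemma exists_apery (N : ℕ) : ∃ a b : Fin N → ℕ,
    Function.Injective (fun i => 4 * a i + 25 * b i) ∧
    ∀ i c d, 4 * a i + 25 * b i ≠ N + (4 * c + 25 * d) := by
  classical
  choose a b h using fun r : Fin N => (Nat.find_spec (exists_mod_eq r)).1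
  refine ⟨a, b, fun i j hij => ?_, fun i c d hcd => ?_⟩
  · have hi := (Nat.find_spec (exists_mod_eq i)).2
    have hj := (Nat.find_spec (exists_mod_eq j)).2
    rw [h] at hi hj
    exact Fin.ext (hi.symm.trans ((congrArg (· % N) hij).trans hj))
  · have hi := (Nat.find_spec (exists_mod_eq i)).2
    have hN := i.pos
    refine Nat.find_min (exists_mod_eq i) (m := 4 * c + 25 * d) ?_ ⟨⟨c, d, rfl⟩, ?_⟩
    · rw [h]; omega
    · rw [h, hcd, Nat.add_mod_left] at hi
      exact hi

/-- If every nonzero pullback of an element of `I` has order in `N + ⟨4, 25⟩`, then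
`ℂ⟦u,v⟧/I` has dimension at least `N`. -/
lemma natCast_le_rank_quotient {ζ : ℂ} (hζ : ζ ≠ 0) (I : Ideal (MvPowerSeries (Fin 2) ℂ)) (N : ℕ)
    (hI : ∀ x ∈ I, pullback ζ x ≠ 0 →
      ∃ c d, (pullback ζ x).order.toNat = N + (4 * c + 25 * d)) :
    (N : Cardinal) ≤ Module.rank ℂ (MvPowerSeries (Fin 2) ℂ ⧸ I) := by
  obtain ⟨a, b, hinj, hap⟩ := exists_apery N
  have hli : LinearIndependent ℂ fun i => Ideal.Quotient.mkₐ ℂ I (U ^ a i * V ^ b i) := by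
    rw [Fintype.linearIndependent_iff]
    intro c hc
    set x := ∑ i, c i • (U ^ a i * V ^ b i) with hx
    have hxI : x ∈ I := by
      rw [← Ideal.Quotient.eq_zero_iff_mem, ← Ideal.Quotient.mkₐ_eq_mk ℂ, hx, map_sum, ← hc]
      simp only [map_smul]
    have hcoeff (n : ℕ) : PowerSeries.coeff n (pullback ζ x) =
        ∑ i, if n = 4 * a i + 25 * b i then c i * ζ ^ b i else 0 := by
      simp [hx, pullback_monomial, PowerSeries.coeff_X_pow, -map_mul, -map_pow,
        PowerSeries.coeff_C_mul]
    have hzero : pullback ζ x = 0 := by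
      by_contra hne
      obtain ⟨p, q, hpq⟩ := hI x hxI hne
      have h := PowerSeries.coeff_order hne
      rw [hcoeff] at h
      obtain ⟨i, -, hi⟩ := Finset.exists_ne_zero_of_sum_ne_zero h
      have hi' := (ite_ne_right_iff.mp hi).1
      exact hap i p q (hi'.symm.trans hpq)
    intro i
    have h := hcoeff (4 * a i + 25 * b i)
    rw [hzero, map_zero, Finset.sum_eq_single i
      (fun j _ hj => if_neg fun hij => hj (hinj hij.symm)) (by simp), if_pos rfl] at h
    exact (mul_eq_zero.mp h.symm).resolve_right (pow_ne_zero _ hζ)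
  simpa using hli.cardinal_le_rank

open PowerSeries in
lemma X_pow_dvd_pullback (ζ : ℂ) {k m : ℕ} (hm : (m : ℤ) ≤ 10 * k - 28)
    {g : MvPowerSeries (Fin 2) ℂ} (hg : g ∈ J₂₅₄ k) : X ^ m ∣ pullback ζ g := by
  have hle : J₂₅₄ k ≤ (Ideal.span {(X ^ m : ℂ⟦X⟧)}).comap (pullback ζ) := by
    refine Ideal.span_le.mpr ?_
    rintro _ ⟨a, b, rfl, hab⟩
    rw [SetLike.mem_coe, Ideal.mem_comap, Ideal.mem_span_singleton, pullback_monomial]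
    exact Dvd.dvd.mul_left (pow_dvd_pow _ (by omega)) _
  exact Ideal.mem_span_singleton.mp (hle hg)

/-- For `f = u²⁵ + v⁴` and any nonzero `g` in the adjunction ideal
`J_{O,k,10}`, `3 ≤ k ≤ 9`, the intersection number `dim_ℂ ℂ⟦u,v⟧/(f,g)` is
strictly greater than `10(k-3)`. -/
theorem iota_B254 (k : ℕ) (hk3 : 3 ≤ k) (hk9 : k ≤ 9)
    (g : MvPowerSeries (Fin 2) ℂ) (hg : g ∈ J₂₅₄ k) (hg0 : g ≠ 0) :
    ((10 * (k - 3) : ℕ) : Cardinal) <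
      Module.rank ℂ
        (MvPowerSeries (Fin 2) ℂ ⧸ Ideal.span {U ^ 25 + V ^ 4, g}) := by
  obtain ⟨ζ, hζ⟩ := IsAlgClosed.exists_pow_nat_eq (-1 : ℂ) (n := 4) (by norm_num)
  have hζ0 : ζ ≠ 0 := by
    rintro rfl
    norm_num at hζ
  have hmem : ∀ x ∈ Ideal.span {U ^ 25 + V ^ 4, g},
      ∃ y, pullback ζ x = pullback ζ g * pullback ζ y := by
    intro x hx
    obtain ⟨p, q, rfl⟩ := Ideal.mem_span_pair.mp hx
    exact ⟨q, by rw [map_add, map_mul, map_mul, pullback_eq_zero hζ, mul_zero, zero_add, mul_comm]⟩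
  obtain ⟨N, hN, hI⟩ : ∃ N, 10 * (k - 3) < N ∧ ∀ x ∈ Ideal.span {U ^ 25 + V ^ 4, g},
      pullback ζ x ≠ 0 → ∃ c d, (pullback ζ x).order.toNat = N + (4 * c + 25 * d) := by
    by_cases hφ : pullback ζ g = 0
    · refine ⟨10 * (k - 3) + 1, Nat.lt_succ_self _, fun x hx hne => absurd ?_ hne⟩
      obtain ⟨y, hy⟩ := hmem x hx
      rw [hy, hφ, zero_mul]
    · refine ⟨(pullback ζ g).order.toNat, ?_, fun x hx hne => ?_⟩
      · by_contra! hlt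
        have hdvd := X_pow_dvd_pullback ζ (k := k) (m := 10 * (k - 3) + 1) (by omega) hg
        exact PowerSeries.coeff_order hφ (PowerSeries.X_pow_dvd_iff.mp hdvd _ (by omega))
      · obtain ⟨y, hy⟩ := hmem x hx
        have hy0 : pullback ζ y ≠ 0 := by
          intro h
          exact hne (by rw [hy, h, mul_zero])
        obtain ⟨c, d, hcd⟩ := exists_of_coeff_pullback_ne_zero (PowerSeries.coeff_order hy0)
        refine ⟨c, d, ?_⟩
        rw [hy, PowerSeries.order_mul, ENat.toNat_add (by simpa using hφ) (by simpa using hy0), hcd]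
  exact (Nat.cast_lt.mpr hN).trans_le (natCast_le_rank_quotient hζ0 _ N hI)
end

section
/- Let f₂ = y² + (x+1)y + x² and f₅ = y⁵ + xy⁴ + 2(x²+x)y³ + ((85/27)x³ + 2x² + x)y² + ((58/27)x⁴ + (58/27)x³)y + (31/27)x⁵, regarded as elements of ℂ⟦x,y⟧. Then the ℂ-vector space ℂ⟦x,y⟧/(f₂, f₅) has dimension 10; i.e., the conic C₂ = {f₂ = 0} and the quintic C₅ = {f₅ = 0} have local intersection multiplicity I(C₂,C₅;O) = 10 at the origin. -/
/-- `x` in `ℂ⟦x,y⟧`. -/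
noncomputable def Xv : MvPowerSeries (Fin 2) ℂ := MvPowerSeries.X 0
/-- `y` in `ℂ⟦x,y⟧`. -/
noncomputable def Yv : MvPowerSeries (Fin 2) ℂ := MvPowerSeries.X 1

/-- The conic `f₂ = y² + (x+1)y + x²`. -/
noncomputable def f₂ : MvPowerSeries (Fin 2) ℂ :=
  Yv ^ 2 + (Xv + 1) * Yv + Xv ^ 2

/-- The quintic
`f₅ = y⁵ + xy⁴ + 2(x²+x)y³ + ((85/27)x³+2x²+x)y² + ((58/27)x⁴+(58/27)x³)y + (31/27)x⁵`. -/
noncomputable def f₅ : MvPowerSeries (Fin 2) ℂ :=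
  Yv ^ 5 + Xv * Yv ^ 4 + 2 * (Xv ^ 2 + Xv) * Yv ^ 3 +
    ((85 / 27 : ℂ) • Xv ^ 3 + 2 * Xv ^ 2 + Xv) * Yv ^ 2 +
    ((58 / 27 : ℂ) • Xv ^ 4 + (58 / 27 : ℂ) • Xv ^ 3) * Yv +
    (31 / 27 : ℂ) • Xv ^ 5

/-- The Taylor polynomial of degree `9` at `x = 0` of the solution `y` of
`y² + (x+1)y + x² = 0` with `y(0) = 0`. -/
def conicBranch {A : Type*} [CommRing A] (x : A) : A :=
  x * (-x + x ^ 2 - 2 * x ^ 3 + 4 * x ^ 4 - 9 * x ^ 5 + 21 * x ^ 6 - 51 * x ^ 7 + 127 * x ^ 8)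

theorem conic_eq_branch {A : Type*} [CommRing A] (x y : A) :
    y ^ 2 + (x + 1) * y + x ^ 2 = (y - conicBranch x) * (y + conicBranch x + x + 1) +
      x ^ 10 * (323 - 512 * x + 707 * x ^ 2 - 1294 * x ^ 3 + 2375 * x ^ 4 - 4428 * x ^ 5 +
        7935 * x ^ 6 - 12954 * x ^ 7 + 16129 * x ^ 8) := by
  unfold conicBranch
  ring

/-- The quintic modulo the conic, expanded along the branch of the conic. The parameter `c`
stands for `1 / 27`. -/
theorem quintic_eq_branch {A : Type*} [CommRing A] (x y c : A) (hc : 27 * c = 1) :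
    y ^ 5 + x * y ^ 4 + 2 * (x ^ 2 + x) * y ^ 3 + (85 * c * x ^ 3 + 2 * x ^ 2 + x) * y ^ 2 +
        (58 * c * x ^ 4 + 58 * c * x ^ 3) * y + 31 * c * x ^ 5 =
      (y ^ 2 + (x + 1) * y + x ^ 2) *
          (-1 - 3 * x - x ^ 2 + 58 * c * x ^ 3 + (1 + 3 * x + x ^ 2) * y - y ^ 2 + y ^ 3) +
        (y - conicBranch x) * (1 + 4 * x + 3 * x ^ 2 - 2 * x ^ 3 - x ^ 4) +
        x ^ 10 * (322 + 462 * x - 203 * x ^ 2 - 127 * x ^ 3) := by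
  unfold conicBranch
  linear_combination (x ^ 3 * y ^ 2 - x ^ 5) * hc

theorem f₂_eq_branch :
    f₂ = (Yv - conicBranch Xv) * (Yv + conicBranch Xv + Xv + 1) +
      Xv ^ 10 * (323 - 512 * Xv + 707 * Xv ^ 2 - 1294 * Xv ^ 3 + 2375 * Xv ^ 4 - 4428 * Xv ^ 5 +
        7935 * Xv ^ 6 - 12954 * Xv ^ 7 + 16129 * Xv ^ 8) :=
  conic_eq_branch Xv Yv

theorem f₅_eq_branch :
    f₅ = f₂ * (-1 - 3 * Xv - Xv ^ 2 + 58 * MvPowerSeries.C (1 / 27 : ℂ) * Xv ^ 3 +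
          (1 + 3 * Xv + Xv ^ 2) * Yv - Yv ^ 2 + Yv ^ 3) +
        (Yv - conicBranch Xv) * (1 + 4 * Xv + 3 * Xv ^ 2 - 2 * Xv ^ 3 - Xv ^ 4) +
        Xv ^ 10 * (322 + 462 * Xv - 203 * Xv ^ 2 - 127 * Xv ^ 3) := by
  have hn (n : ℕ) [n.AtLeastTwo] : (MvPowerSeries.C (OfNat.ofNat n / 27 : ℂ) :
      MvPowerSeries (Fin 2) ℂ) = OfNat.ofNat n * MvPowerSeries.C (1 / 27 : ℂ) := by
    rw [div_eq_mul_one_div, map_mul, map_ofNat]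
  have hc : 27 * (MvPowerSeries.C (1 / 27 : ℂ) : MvPowerSeries (Fin 2) ℂ) = 1 := by
    rw [← hn, ← map_one MvPowerSeries.C]
    norm_num
  rw [f₂, ← quintic_eq_branch Xv Yv _ hc, f₅]
  simp only [MvPowerSeries.smul_eq_C_mul, hn]

theorem constantCoeff_Xv : MvPowerSeries.constantCoeff Xv = 0 := MvPowerSeries.constantCoeff_X 0

theorem constantCoeff_Yv : MvPowerSeries.constantCoeff Yv = 0 := MvPowerSeries.constantCoeff_X 1

theorem Xv_pow_ten_mem : Xv ^ 10 ∈ Ideal.span {f₂, f₅} := by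
  have h2 : f₂ ∈ Ideal.span {f₂, f₅} := Ideal.subset_span (by simp)
  have h5 : f₅ ∈ Ideal.span {f₂, f₅} := Ideal.subset_span (by simp)
  set u := Yv + conicBranch Xv + Xv + 1 with hu
  set q := 323 - 512 * Xv + 707 * Xv ^ 2 - 1294 * Xv ^ 3 + 2375 * Xv ^ 4 - 4428 * Xv ^ 5 +
    7935 * Xv ^ 6 - 12954 * Xv ^ 7 + 16129 * Xv ^ 8 with hq
  set a := 1 + 4 * Xv + 3 * Xv ^ 2 - 2 * Xv ^ 3 - Xv ^ 4 with ha
  set r := 322 + 462 * Xv - 203 * Xv ^ 2 - 127 * Xv ^ 3 with hr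
  have hunit : IsUnit (u * r - a * q) := by
    rw [MvPowerSeries.isUnit_iff_constantCoeff]
    simp [hu, hq, ha, hr, conicBranch, constantCoeff_Xv, constantCoeff_Yv, map_ofNat]
    norm_num
  rw [← Ideal.mul_unit_mem_iff_mem _ hunit]
  have e2 := f₂_eq_branch
  have e5 := f₅_eq_branch
  rw [← hu, ← hq] at e2
  rw [← ha, ← hr] at e5
  set g := -1 - 3 * Xv - Xv ^ 2 + 58 * MvPowerSeries.C (1 / 27 : ℂ) * Xv ^ 3 +
          (1 + 3 * Xv + Xv ^ 2) * Yv - Yv ^ 2 + Yv ^ 3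
  have : Xv ^ 10 * (u * r - a * q) = u * f₅ - (u * g + a) * f₂ := by
    linear_combination a * e2 - u * e5
  rw [this]
  exact sub_mem (Ideal.mul_mem_left _ _ h5) (Ideal.mul_mem_left _ _ h2)

theorem Yv_sub_branch_mem : Yv - conicBranch Xv ∈ Ideal.span {f₂, f₅} := by
  have h2 : f₂ ∈ Ideal.span {f₂, f₅} := Ideal.subset_span (by simp)
  have hunit : IsUnit (Yv + conicBranch Xv + Xv + 1) := by
    rw [MvPowerSeries.isUnit_iff_constantCoeff]
    simp [conicBranch, constantCoeff_Xv, constantCoeff_Yv]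
  rw [← Ideal.mul_unit_mem_iff_mem _ hunit, eq_sub_of_add_eq f₂_eq_branch.symm]
  exact sub_mem h2 (Ideal.mul_mem_right _ _ Xv_pow_ten_mem)

theorem exists_eq_C_add_Xv_mul_add_Yv_mul (f : MvPowerSeries (Fin 2) ℂ) :
    ∃ (a : ℂ) (g h : MvPowerSeries (Fin 2) ℂ), f = MvPowerSeries.C a + Xv * g + Yv * h := by
  let a := MvPowerSeries.constantCoeff f
  let h : MvPowerSeries (Fin 2) ℂ := fun m ↦
    if m 0 = 0 then MvPowerSeries.coeff (Finsupp.single 1 1 + m) f else 0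
  suffices Xv ∣ f - MvPowerSeries.C a - Yv * h by
    obtain ⟨g, hg⟩ := this
    exact ⟨a, g, h, by linear_combination hg⟩
  refine MvPowerSeries.X_dvd_iff.mpr fun m hm ↦ ?_
  by_cases hm1 : m 1 = 0
  · have : m = 0 := by
      ext i
      fin_cases i <;> simpa
    subst this
    simp [a, constantCoeff_Yv]
  · obtain ⟨k, rfl⟩ : ∃ k, m = Finsupp.single 1 1 + k :=
      exists_add_of_le (by simpa [Finsupp.single_le_iff] using Nat.one_le_iff_ne_zero.mpr hm1)
    have hk : k 0 = 0 := by simpa using hm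
    have hne : Finsupp.single 1 1 + k ≠ 0 := fun h0 ↦ hm1 (by rw [h0]; rfl)
    rw [map_sub, map_sub, MvPowerSeries.coeff_C, if_neg hne, Yv, MvPowerSeries.X_def,
      MvPowerSeries.coeff_add_monomial_mul]
    have hh : MvPowerSeries.coeff k h = MvPowerSeries.coeff (Finsupp.single 1 1 + k) f := if_pos hk
    rw [hh, sub_zero, one_mul, sub_self]

theorem exists_sub_sum_mem {J : Ideal (MvPowerSeries (Fin 2) ℂ)} {w : MvPowerSeries (Fin 2) ℂ}
    (hw : Yv - Xv * w ∈ J) (n : ℕ) (f : MvPowerSeries (Fin 2) ℂ) :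
    ∃ (a : ℕ → ℂ) (g : MvPowerSeries (Fin 2) ℂ),
      f - (∑ i ∈ Finset.range n, MvPowerSeries.C (a i) * Xv ^ i + Xv ^ n * g) ∈ J := by
  induction n with
  | zero => exact ⟨0, f, by simp⟩
  | succ n ih =>
    obtain ⟨a, g, hg⟩ := ih
    obtain ⟨b, g', h, rfl⟩ := exists_eq_C_add_Xv_mul_add_Yv_mul g
    refine ⟨Function.update a n b, g' + w * h, ?_⟩
    have hsum : ∑ i ∈ Finset.range n, MvPowerSeries.C (Function.update a n b i) * Xv ^ i =
        ∑ i ∈ Finset.range n, MvPowerSeries.C (a i) * Xv ^ i :=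
      Finset.sum_congr rfl fun i hi ↦ by
        rw [Function.update_of_ne (Finset.mem_range.mp hi).ne]
    rw [Finset.sum_range_succ, hsum, Function.update_self]
    convert add_mem hg (J.mul_mem_left (Xv ^ n * h) hw) using 1
    ring

theorem hasSubst_conicBranch :
    MvPowerSeries.HasSubst (![PowerSeries.X, conicBranch PowerSeries.X] : Fin 2 → PowerSeries ℂ) :=
  MvPowerSeries.hasSubst_of_constantCoeff_zero fun i ↦ by
    change PowerSeries.constantCoeff _ = 0
    fin_cases i <;> simp [conicBranch]

/-- Restriction of a power series to the truncated branch `y = conicBranch x` of the conic. -/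
noncomputable def restrictBranch : MvPowerSeries (Fin 2) ℂ →ₐ[ℂ] PowerSeries ℂ :=
  MvPowerSeries.substAlgHom hasSubst_conicBranch

theorem restrictBranch_Xv : restrictBranch Xv = PowerSeries.X :=
  MvPowerSeries.substAlgHom_X hasSubst_conicBranch 0

theorem restrictBranch_Yv : restrictBranch Yv = conicBranch PowerSeries.X :=
  MvPowerSeries.substAlgHom_X hasSubst_conicBranch 1

theorem restrictBranch_C (a : ℂ) : restrictBranch (MvPowerSeries.C a) = PowerSeries.C a :=
  restrictBranch.commutes a

theorem map_conicBranch {A B : Type*} [CommRing A] [CommRing B] (φ : A →+* B) (x : A) :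
    φ (conicBranch x) = conicBranch (φ x) := by
  simp [conicBranch, map_ofNat]

theorem restrictBranch_Yv_sub_branch : restrictBranch (Yv - conicBranch Xv) = 0 := by
  have := map_conicBranch (restrictBranch : MvPowerSeries (Fin 2) ℂ →+* PowerSeries ℂ) Xv
  rw [RingHom.coe_coe] at this
  rw [map_sub, this, restrictBranch_Xv, restrictBranch_Yv, sub_self]

theorem X_pow_ten_dvd_restrictBranch_f₂ : PowerSeries.X ^ 10 ∣ restrictBranch f₂ := by
  rw [f₂_eq_branch, map_add, map_mul, restrictBranch_Yv_sub_branch, zero_mul, zero_add, map_mul,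
    map_pow, restrictBranch_Xv]
  exact dvd_mul_right _ _

theorem X_pow_ten_dvd_restrictBranch_f₅ : PowerSeries.X ^ 10 ∣ restrictBranch f₅ := by
  rw [f₅_eq_branch, map_add, map_add, map_mul, map_mul _ (Yv - _), restrictBranch_Yv_sub_branch,
    zero_mul, add_zero, map_mul _ (Xv ^ 10), map_pow, restrictBranch_Xv]
  exact dvd_add (X_pow_ten_dvd_restrictBranch_f₂.mul_right _) (dvd_mul_right _ _)

theorem X_pow_ten_dvd_restrictBranch {f : MvPowerSeries (Fin 2) ℂ}
    (hf : f ∈ Ideal.span {f₂, f₅}) : PowerSeries.X ^ 10 ∣ restrictBranch f := by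
  obtain ⟨a, b, rfl⟩ := Ideal.mem_span_pair.mp hf
  rw [map_add, map_mul, map_mul]
  exact dvd_add (X_pow_ten_dvd_restrictBranch_f₂.mul_left _)
    (X_pow_ten_dvd_restrictBranch_f₅.mul_left _)

/-- The first ten Taylor coefficients along the branch of the conic. -/
noncomputable def branchCoeffs : MvPowerSeries (Fin 2) ℂ →ₗ[ℂ] (Fin 10 → ℂ) :=
  LinearMap.pi fun i ↦ PowerSeries.coeff (i : ℕ) ∘ₗ restrictBranch.toLinearMap

theorem branchCoeffs_apply (f : MvPowerSeries (Fin 2) ℂ) (i : Fin 10) :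
    branchCoeffs f i = PowerSeries.coeff (i : ℕ) (restrictBranch f) := rfl

theorem branchCoeffs_eq_zero_iff {f : MvPowerSeries (Fin 2) ℂ} :
    branchCoeffs f = 0 ↔ PowerSeries.X ^ 10 ∣ restrictBranch f := by
  rw [PowerSeries.X_pow_dvd_iff, funext_iff]
  exact ⟨fun h m hm ↦ h ⟨m, hm⟩, fun h i ↦ h i i.2⟩

theorem branchCoeffs_sum (a : ℕ → ℂ) (i : Fin 10) :
    branchCoeffs (∑ j ∈ Finset.range 10, MvPowerSeries.C (a j) * Xv ^ j) i = a i := by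
  simp [branchCoeffs_apply, restrictBranch_C, restrictBranch_Xv, PowerSeries.coeff_X_pow]

theorem branchCoeffs_surjective : Function.Surjective branchCoeffs := fun v ↦
  ⟨∑ j ∈ Finset.range 10, MvPowerSeries.C (if h : j < 10 then v ⟨j, h⟩ else 0) * Xv ^ j, by
    ext i
    rw [branchCoeffs_sum fun j ↦ if h : j < 10 then v ⟨j, h⟩ else 0]
    simp⟩

theorem ker_branchCoeffs :
    LinearMap.ker branchCoeffs = (Ideal.span {f₂, f₅}).restrictScalars ℂ := by
  ext f
  rw [LinearMap.mem_ker, Submodule.restrictScalars_mem]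
  refine ⟨fun hf ↦ ?_, fun hf ↦ branchCoeffs_eq_zero_iff.mpr (X_pow_ten_dvd_restrictBranch hf)⟩
  obtain ⟨a, g, hg⟩ := exists_sub_sum_mem Yv_sub_branch_mem 10 f
  have hX : Xv ^ 10 * g ∈ Ideal.span {f₂, f₅} := Ideal.mul_mem_right _ _ Xv_pow_ten_mem
  have hmem := add_mem hg hX
  rw [← sub_sub, sub_add_cancel] at hmem
  have h0 := branchCoeffs_eq_zero_iff.mpr (X_pow_ten_dvd_restrictBranch hmem)
  rw [map_sub, hf, zero_sub, neg_eq_zero] at h0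
  have hsum : ∑ j ∈ Finset.range 10, MvPowerSeries.C (a j) * Xv ^ j = 0 :=
    Finset.sum_eq_zero fun j hj ↦ by
      have := branchCoeffs_sum a ⟨j, Finset.mem_range.mp hj⟩
      rw [h0] at this
      rw [← this]
      simp
  rwa [hsum, sub_zero] at hmem

/-- The local intersection multiplicity of `C₂ = {f₂ = 0}` and `C₅ = {f₅ = 0}` at the
origin is `10`: `dim_ℂ ℂ⟦x,y⟧/(f₂,f₅) = 10`. -/
theorem intersection_multiplicity_ten :
    Module.finrank ℂ (MvPowerSeries (Fin 2) ℂ ⧸ Ideal.span {f₂, f₅}) = 10 := by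
  rw [← (Submodule.Quotient.restrictScalarsEquiv ℂ (Ideal.span {f₂, f₅})).finrank_eq,
    ← ker_branchCoeffs,
    (branchCoeffs.quotKerEquivOfSurjective branchCoeffs_surjective).finrank_eq,
    Module.finrank_fin_fun]
end
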